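/- Under the standing hypotheses, no three of the four numbers a + 6d, a + 5d, a + 4d, a + 3d can be written in the 3-dominated form with top exponent m: there do not exist nonnegative integers p > q > r such that 3^m + 2^p, 3^m + 2^q, and 3^m + 2^r are three distinct elements of {a + 6d, a + 5d, a + 4d, a + 3d}. -/

import Mathlib

/-- No power of 3 greater than 9 is the sum of a power of 3 and a power of 2. -/
theorem three_pow_ne_three_pow_add_two_pow {m : ℕ} (hm : 3 ≤ m) (x y : ℕ) :
    3 ^ m ≠ 3 ^ x + 2 ^ y := by
  intro h
  have hdvd {p : ℕ} (hp : p.Prime) (hp' : p ∣ 2 ^ y) : p = 2 :=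
    (Nat.prime_dvd_prime_iff_eq hp Nat.prime_two).mp (hp.dvd_of_dvd_pow hp')
  have hx : x = 0 := by
    by_contra hx
    have h3m : 3 ∣ 3 ^ m := dvd_pow_self 3 (by omega)
    have h3x : 3 ∣ 3 ^ x := dvd_pow_self 3 hx
    have := hdvd Nat.prime_three (by omega)
    omega
  subst hx
  have h27 : 3 ^ 3 ≤ 3 ^ m := Nat.pow_le_pow_right (by norm_num) hm
  have hy : 4 ≤ y := by
    by_contra! hy
    interval_cases y <;> omega
  have h16 : 16 ∣ 2 ^ y := pow_dvd_pow 2 hy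
  -- The order of 3 modulo 16 is 4, so `80 = 3 ^ 4 - 1` divides `3 ^ m - 1`.
  have hdecomp : 3 ^ m = 81 ^ (m / 4) * 3 ^ (m % 4) := by
    conv_lhs => rw [← Nat.div_add_mod m 4, pow_add, pow_mul]
    norm_num
  have h81 : 81 ^ (m / 4) % 80 = 1 := by simp [Nat.pow_mod]
  have hlt : m % 4 < 4 := Nat.mod_lt _ (by norm_num)
  have h5 : 5 ∣ 2 ^ y := by
    interval_cases m % 4 <;> omega
  have := hdvd Nat.prime_five h5
  omega

/-- Under the standing hypotheses, no three of a + 6d, a + 5d, a + 4d, a + 3d are 3-dominated (of the form 3^m + 2^y). -/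
theorem no_three_3_dominated (a d m n : ℕ)
    (ha : 0 < a) (hd : 0 < d)
    (hAP : ∀ i : ℕ, i ≤ 6 → ∃ x y : ℕ, a + i * d = 3 ^ x + 2 ^ y)
    (hbig : 3 ^ 9 ≤ a + 6 * d)
    (hm₁ : 3 ^ m ≤ a + 6 * d) (hm₂ : a + 6 * d < 3 ^ (m + 1))
    (hn₁ : 2 ^ n ≤ a + 6 * d) (hn₂ : a + 6 * d < 2 ^ (n + 1)) :
    ¬ ∃ p q r : ℕ, r < q ∧ q < p ∧
      3 ^ m + 2 ^ p ∈ ({a + 6 * d, a + 5 * d, a + 4 * d, a + 3 * d} : Set ℕ) ∧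
      3 ^ m + 2 ^ q ∈ ({a + 6 * d, a + 5 * d, a + 4 * d, a + 3 * d} : Set ℕ) ∧
      3 ^ m + 2 ^ r ∈ ({a + 6 * d, a + 5 * d, a + 4 * d, a + 3 * d} : Set ℕ) := by
  rintro ⟨p, q, r, hrq, hqp, hp, hq, hr⟩
  have hX : 0 < 2 ^ r := by positivity
  have hXY : 2 * 2 ^ r ≤ 2 ^ q := by
    rw [← pow_succ']
    exact Nat.pow_le_pow_right two_pos hrq
  have hYZ : 2 ^ p = 2 * 2 ^ q ∨ 4 * 2 ^ q ≤ 2 ^ p := by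
    rcases (Nat.succ_le_of_lt hqp).eq_or_lt with rfl | h
    · exact .inl (pow_succ' 2 q)
    · have := Nat.pow_le_pow_right two_pos h
      simp only [Nat.succ_eq_add_one, pow_succ] at this
      omega
  have key : 3 ^ m = a + 2 * d := by
    simp only [Set.mem_insert_iff, Set.mem_singleton_iff] at hp hq hr
    omega
  have hm : 3 ≤ m := by
    have := (Nat.pow_lt_pow_iff_right (by norm_num : 1 < 3)).mp (hbig.trans_lt hm₂)
    omega
  obtain ⟨x, y, hxy⟩ := hAP 2 (by norm_num)
  exact three_pow_ne_three_pow_add_two_pow hm x y (key.trans hxy)
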